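/- Let U be a normal ultrafilter on a measurable cardinal δ and let λ be a limit ordinal. If there is an unbounded subset of cof(λ)^{Ult(V,U)} that is fresh over Ult(V,U), then there is an unbounded subset of λ that is fresh over Ult(V,U). -/

import Mathlib

noncomputable section

open Cardinal Set

namespace MU

/-- The type of ordinals below the initial ordinal of `δ`, serving as the underlying
set of the cardinal `δ` and indexing the ultrapower. -/
abbrev Idx (δ : Cardinal.{0}) : Type 1 := {o : Ordinal.{0} // o < δ.ord}

/-- A filter `F` is `κ`-complete (equivalently, `<κ`-closed): it is closed under
intersections of fewer than `κ` of its members. -/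
def IsCComplete (κ : Cardinal.{0}) {X : Type*} (F : Filter X) : Prop :=
  ∀ (ι : Type) (t : ι → Set X), #ι < κ → (∀ j, t j ∈ F) → (⋂ j, t j) ∈ F

/-- `U` is a normal ultrafilter on the measurable cardinal `δ`: `δ` is uncountable and
`U` is a `δ`-complete nonprincipal ultrafilter on `δ` such that every function that is
regressive on a set in `U` is constant on a set in `U`. -/
structure IsNormalUltrafilter (δ : Cardinal.{0}) (U : Ultrafilter (Idx δ)) : Prop where
  uncountable : ℵ₀ < δ
  complete : IsCComplete δ (U : Filter (Idx δ))
  nonprincipal : ∀ i : Idx δ, ({i} : Set (Idx δ)) ∉ U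
  normal : ∀ f : Idx δ → Ordinal.{0}, { i : Idx δ | f i < i.1 } ∈ U →
    ∃ c : Ordinal.{0}, { i : Idx δ | f i = c } ∈ U

variable {δ : Cardinal.{0}} {U : Ultrafilter (Idx δ)}

/-- The Łoś ordering on representatives of ordinals of the ultrapower `Ult(V,U)`. -/
def ultLT (U : Ultrafilter (Idx δ)) (f g : Idx δ → Ordinal.{0}) : Prop :=
  { i : Idx δ | f i < g i } ∈ U

theorem ultLT_wf (hU : IsNormalUltrafilter δ U) : WellFounded (ultLT U) := by
  haveI : IsIrrefl (Idx δ → Ordinal.{0}) (ultLT U) := by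
    constructor
    intro f hf
    have h : ({ i : Idx δ | f i < f i } : Set (Idx δ)) = ∅ := by ext i; simp
    rw [ultLT, h] at hf
    exact Filter.empty_notMem (U : Filter (Idx δ)) hf
  haveI : IsTrans (Idx δ → Ordinal.{0}) (ultLT U) := by
    constructor
    intro f g h hfg hgh
    have hsub : ({ i : Idx δ | f i < g i } ∩ { i : Idx δ | g i < h i } : Set (Idx δ)) ⊆
        { i : Idx δ | f i < h i } := fun i hi => show f i < h i from lt_trans hi.1 hi.2
    exact Filter.mem_of_superset (Filter.inter_mem hfg hgh) hsub
  haveI : IsStrictOrder (Idx δ → Ordinal.{0}) (ultLT U) := ⟨⟩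
  rw [RelEmbedding.wellFounded_iff_isEmpty]
  constructor
  intro g
  have hmem : ∀ n : ℕ, { i : Idx δ | g (n + 1) i < g n i } ∈ U :=
    fun n => g.map_rel_iff.2 (Nat.lt_succ_self n)
  have hint : (⋂ n : ℕ, { i : Idx δ | g (n + 1) i < g n i }) ∈ U := by
    refine hU.complete ℕ _ ?_ hmem
    rw [Cardinal.mk_nat]
    exact hU.uncountable
  obtain ⟨i, hi⟩ := Ultrafilter.nonempty_of_mem hint
  have hdesc : ∀ n : ℕ, (fun n => g n i) (n + 1) < (fun n => g n i) n :=
    fun n => Set.mem_iInter.1 hi n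
  exact (RelEmbedding.wellFounded_iff_isEmpty.1 Ordinal.lt_wf).false
    (RelEmbedding.natGT (fun n => g n i) hdesc)

/-- The ordinal represented by `f` in the transitive collapse of the ultrapower
`Ult(V,U)`, i.e. the rank of `f` in the (well-founded) Łoś ordering. -/
def ordRank (hU : IsNormalUltrafilter δ U) (f : Idx δ → Ordinal.{0}) : Ordinal.{0} :=
  sInf { o : Ordinal.{0} | Ordinal.lift.{1} o = ((ultLT_wf hU).apply f).rank }

/-- The image of an ordinal under the ultrapower embedding `j_U : V → Ult(V,U)`. -/
def jU (hU : IsNormalUltrafilter δ U) (o : Ordinal.{0}) : Ordinal.{0} :=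
  ordRank hU fun _ => o

/-- The set of ordinals that is the transitive collapse of the element of the
ultrapower `Ult(V,U)` represented by the function `f`. -/
def ultSet (hU : IsNormalUltrafilter δ U) (f : Idx δ → Set Ordinal.{0}) :
    Set Ordinal.{0} :=
  { o : Ordinal.{0} |
    ∃ g : Idx δ → Ordinal.{0}, { i : Idx δ | g i ∈ f i } ∈ U ∧ ordRank hU g = o }

/-- A set of ordinals is (the transitive collapse of) an element of the ultrapower
`Ult(V,U)`. -/
def InUlt (hU : IsNormalUltrafilter δ U) (A : Set Ordinal.{0}) : Prop :=
  ∃ f : Idx δ → Set Ordinal.{0}, (∀ i, BddAbove (f i)) ∧ A = ultSet hU f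

/-- The least upper bound of a set of ordinals. -/
def lub (A : Set Ordinal.{0}) : Ordinal.{0} :=
  sSup ((fun o => o + 1) '' A)

/-- Hamkins: a set `A` of ordinals is fresh over `Ult(V,U)` if `A ∉ Ult(V,U)` but
`A ∩ α ∈ Ult(V,U)` for every `α < lub A`. -/
def Fresh (hU : IsNormalUltrafilter δ U) (A : Set Ordinal.{0}) : Prop :=
  ¬ InUlt hU A ∧ ∀ α < lub A, InUlt hU (A ∩ Iio α)

/-- `A` is an unbounded subset of the ordinal `l`. -/
def UnbSub (A : Set Ordinal.{0}) (l : Ordinal.{0}) : Prop :=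
  A ⊆ Iio l ∧ ∀ b < l, ∃ a ∈ A, b ≤ a

/-- `A` is a closed subset of the ordinal `l`: it contains the suprema of all of its
nonempty subsets that are bounded below `l`. -/
def ClosedIn (A : Set Ordinal.{0}) (l : Ordinal.{0}) : Prop :=
  ∀ S ⊆ A, S.Nonempty → sSup S < l → sSup S ∈ A

/-- The set of limit points of a set of ordinals. -/
def limitPts (A : Set Ordinal.{0}) : Set Ordinal.{0} :=
  { b : Ordinal.{0} | (A ∩ Iio b).Nonempty ∧ sSup (A ∩ Iio b) = b }

/-- `S` is a stationary subset of the ordinal `l`. -/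
def StationaryIn (S : Set Ordinal.{0}) (l : Ordinal.{0}) : Prop :=
  S ⊆ Iio l ∧ ∀ D : Set Ordinal.{0}, ClosedIn D l → UnbSub D l → (S ∩ D).Nonempty

/-- The order type of the set of ordinals `C` is at most `o`. -/
def otpLE (C : Set Ordinal.{0}) (o : Ordinal.{0}) : Prop :=
  ∃ g : Ordinal.{0} → Ordinal.{0}, (∀ a ∈ C, g a < o) ∧
    ∀ a ∈ C, ∀ b ∈ C, a < b → g a < g b

/-- The order type of the set of ordinals `C` is (strictly) less than `o`. -/
def otpLT (C : Set Ordinal.{0}) (o : Ordinal.{0}) : Prop :=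
  ∃ o' < o, otpLE C o'

/-- `C` is a `□(Θ)`-sequence, where `Θ` is (the initial ordinal of) an uncountable
regular cardinal. -/
structure IsSquareSeq (Θ : Ordinal.{0}) (C : Ordinal.{0} → Set Ordinal.{0}) : Prop where
  closed : ∀ γ < Θ, Order.IsSuccLimit γ → ClosedIn (C γ) γ
  unbounded : ∀ γ < Θ, Order.IsSuccLimit γ → UnbSub (C γ) γ
  coherent : ∀ γ < Θ, Order.IsSuccLimit γ → ∀ β ∈ limitPts (C γ), β < γ → C β = C γ ∩ Iio β
  nontrivial : ¬ ∃ D : Set Ordinal.{0}, ClosedIn D Θ ∧ UnbSub D Θ ∧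
    ∀ γ ∈ limitPts D, γ < Θ → D ∩ Iio γ = C γ

/-- `C` is a `□_κ`-sequence: a `□(κ⁺)`-sequence all of whose clubs have order type
at most `κ`. -/
def IsSquareKappaSeq (κ : Cardinal.{0}) (C : Ordinal.{0} → Set Ordinal.{0}) : Prop :=
  IsSquareSeq (Order.succ κ).ord C ∧
    ∀ γ < (Order.succ κ).ord, Order.IsSuccLimit γ → otpLE (C γ) κ.ord

/-- `κ` is a weakly compact cardinal: `κ` is uncountable and every coloring of the
pairs of ordinals below `κ` in fewer than `κ` colors has a homogeneous set of size `κ`. -/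
def IsWeaklyCompact (κ : Cardinal.{0}) : Prop :=
  ℵ₀ < κ ∧ ∀ (ν : Type) (c : Ordinal.{0} → Ordinal.{0} → ν), #ν < κ →
    ∃ H : Set Ordinal.{0}, H ⊆ Iio κ.ord ∧ Cardinal.lift.{1} κ ≤ #H ∧
      ∀ a ∈ H, ∀ b ∈ H, ∀ a' ∈ H, ∀ b' ∈ H, a < b → a' < b' → c a b = c a' b'

/-- `κ` is a strongly compact cardinal: every `κ`-complete filter (on any set)
extends to a `κ`-complete ultrafilter. -/
def IsStronglyCompact (κ : Cardinal.{0}) : Prop :=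
  ∀ (X : Type) (F : Filter X), IsCComplete κ F →
    ∃ G : Ultrafilter X, F ≤ (G : Filter X) ∧ IsCComplete κ (G : Filter X)

/-- `κ` is a singular cardinal. -/
def IsSingular (κ : Cardinal.{0}) : Prop :=
  ℵ₀ ≤ κ ∧ κ.ord.cof < κ

/-- The cofinality of the ordinal `l` as computed inside the ultrapower `Ult(V,U)`
(as an ordinal, i.e. the image of the ultrapower's cofinality under the transitive
collapse). -/
def cofUlt (hU : IsNormalUltrafilter δ U) (l : Ordinal.{0}) : Ordinal.{0} :=
  sInf { c : Ordinal.{0} | ∃ f : Idx δ → Ordinal.{0},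
    ordRank hU f = l ∧ ordRank hU (fun i => ((f i).cof).ord) = c }

/-- The ordinal `o` is (the transitive collapse of) a cardinal of the ultrapower
`Ult(V,U)`. -/
def CardInUlt (hU : IsNormalUltrafilter δ U) (o : Ordinal.{0}) : Prop :=
  ∃ f : Idx δ → Ordinal.{0}, ordRank hU f = o ∧
    { i : Idx δ | ((f i).card).ord = f i } ∈ U

/-- The ordinal `o` is (the transitive collapse of) a regular cardinal of the
ultrapower `Ult(V,U)`. -/
def RegularInUlt (hU : IsNormalUltrafilter δ U) (o : Ordinal.{0}) : Prop :=
  ∃ f : Idx δ → Ordinal.{0}, ordRank hU f = o ∧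
    { i : Idx δ | ((f i).card).IsRegular ∧ ((f i).card).ord = f i } ∈ U

/-- The cardinal successor of the ordinal `o` as computed inside the ultrapower
`Ult(V,U)`: the least ordinal above `o` that is a cardinal in `Ult(V,U)`. -/
def succInUlt (hU : IsNormalUltrafilter δ U) (o : Ordinal.{0}) : Ordinal.{0} :=
  sInf { c : Ordinal.{0} | o < c ∧ CardInUlt hU c }

/-- The cardinality of a set of ordinals, as an (initial) ordinal: the least ordinal
`o` such that `s` is the image of a function defined on the ordinals below `o`. -/
def setCardOrd (s : Set Ordinal.{0}) : Ordinal.{0} :=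
  sInf { o : Ordinal.{0} | ∃ g : Ordinal.{0} → Ordinal.{0}, s ⊆ g '' Iio o }

theorem rank_le_of_eventually_le (hU : IsNormalUltrafilter δ U) {f g : Idx δ → Ordinal.{0}}
    (h : ∀ᶠ i in (U : Filter (Idx δ)), f i ≤ g i) :
    ((ultLT_wf hU).apply f).rank ≤ ((ultLT_wf hU).apply g).rank := by
  rw [Acc.rank_eq]
  refine Ordinal.iSup_le fun ⟨k, hk⟩ => Order.succ_le_of_lt ?_
  refine Acc.rank_lt_of_rel _ (a := k) ?_
  filter_upwards [h, hk] with i h₁ h₂ using lt_of_lt_of_le h₂ h₁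

theorem lift_ordRank (hU : IsNormalUltrafilter δ U) (f : Idx δ → Ordinal.{0}) :
    Ordinal.lift.{1} (ordRank hU f) = ((ultLT_wf hU).apply f).rank := by
  induction f using (ultLT_wf hU).induction with
  | _ f ih =>
    let T : ((i : Idx δ) → Iic (f i)) → Ordinal.{0} := fun p => ordRank hU fun i => p i
    have : Small.{0} (Idx δ) := inferInstanceAs (Small.{0} (Iio δ.ord))
    obtain ⟨β, hβ⟩ := Ordinal.bddAbove_of_small (s := range T)
    have hle : ((ultLT_wf hU).apply f).rank ≤ Ordinal.lift.{1} (Order.succ β) := by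
      rw [Acc.rank_eq]
      refine Ordinal.iSup_le fun ⟨g, hg⟩ => ?_
      have hm : ultLT U (fun i => min (g i) (f i)) f := by
        filter_upwards [hg] with i hi using lt_of_le_of_lt (min_le_left _ _) hi
      have hgm : ((ultLT_wf hU).apply g).rank ≤
          ((ultLT_wf hU).apply fun i => min (g i) (f i)).rank := by
        refine rank_le_of_eventually_le hU ?_
        filter_upwards [hg] with i hi using le_min le_rfl (le_of_lt hi)
      rw [Ordinal.lift_succ, Order.succ_le_succ_iff]
      refine hgm.trans ?_
      rw [← ih _ hm, Ordinal.lift_le]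
      exact hβ ⟨fun i => ⟨min (g i) (f i), mem_Iic.2 (min_le_right _ _)⟩, rfl⟩
    exact csInf_mem (s := {o : Ordinal.{0} | Ordinal.lift.{1} o = ((ultLT_wf hU).apply f).rank})
      (Ordinal.mem_range_lift_of_le hle)

theorem ordRank_lt_iff (hU : IsNormalUltrafilter δ U) {f g : Idx δ → Ordinal.{0}} :
    ordRank hU f < ordRank hU g ↔ ∀ᶠ i in (U : Filter (Idx δ)), f i < g i := by
  rw [← Ordinal.lift_lt.{1}, lift_ordRank, lift_ordRank]
  refine ⟨fun h => ?_, fun h => Acc.rank_lt_of_rel _ (a := f) h⟩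
  by_contra hn
  rw [← Ultrafilter.eventually_not] at hn
  exact h.not_ge (rank_le_of_eventually_le hU (hn.mono fun i hi => not_lt.1 hi))

theorem ordRank_le_iff (hU : IsNormalUltrafilter δ U) {f g : Idx δ → Ordinal.{0}} :
    ordRank hU f ≤ ordRank hU g ↔ ∀ᶠ i in (U : Filter (Idx δ)), f i ≤ g i := by
  rw [← not_lt, ordRank_lt_iff, ← Ultrafilter.eventually_not]
  simp only [not_lt]

theorem ordRank_eq_iff (hU : IsNormalUltrafilter δ U) {f g : Idx δ → Ordinal.{0}} :
    ordRank hU f = ordRank hU g ↔ ∀ᶠ i in (U : Filter (Idx δ)), f i = g i := by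
  simp only [le_antisymm_iff, ordRank_le_iff, Filter.eventually_and]

theorem ordRank_surjective (hU : IsNormalUltrafilter δ U) :
    Function.Surjective (ordRank hU) := by
  intro o
  have hmono : StrictMono fun o : Ordinal.{0} => ordRank hU fun _ => o := fun a b hab =>
    (ordRank_lt_iff hU).2 (Filter.Eventually.of_forall fun _ => hab)
  have ho : Ordinal.lift.{1} o ≤ ((ultLT_wf hU).apply fun _ => o).rank := by
    rw [← lift_ordRank, Ordinal.lift_le]
    exact hmono.le_apply
  obtain ⟨g, hg, hgo⟩ := Acc.mem_range_rank_of_le _ ho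
  refine ⟨g, Ordinal.lift_inj.{1, 0}.1 ?_⟩
  rw [lift_ordRank, ← hgo]

theorem ordRank_mem_ultSet_iff (hU : IsNormalUltrafilter δ U) {g : Idx δ → Ordinal.{0}}
    {s : Idx δ → Set Ordinal.{0}} :
    ordRank hU g ∈ ultSet hU s ↔ ∀ᶠ i in (U : Filter (Idx δ)), g i ∈ s i := by
  refine ⟨?_, fun h => ⟨g, h, rfl⟩⟩
  rintro ⟨k, hk, hkg⟩
  filter_upwards [hk, (ordRank_eq_iff hU).1 hkg] with i h₁ h₂
  rw [← h₂]
  exact h₁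

theorem cofUlt_ordRank (hU : IsNormalUltrafilter δ U) (f : Idx δ → Ordinal.{0}) :
    cofUlt hU (ordRank hU f) = ordRank hU fun i => (f i).cof.ord := by
  have : {c : Ordinal.{0} | ∃ k : Idx δ → Ordinal.{0}, ordRank hU k = ordRank hU f ∧
      ordRank hU (fun i => (k i).cof.ord) = c} = {ordRank hU fun i => (f i).cof.ord} := by
    ext c
    constructor
    · rintro ⟨k, hk, rfl⟩
      refine (ordRank_eq_iff hU).2 ?_
      filter_upwards [(ordRank_eq_iff hU).1 hk] with i hi
      rw [hi]
    · rintro rfl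
      exact ⟨f, rfl, rfl⟩
  rw [cofUlt, this, csInf_singleton]

theorem exists_strictMonoOn_cofinal (o : Ordinal.{0}) :
    ∃ c : Ordinal.{0} → Ordinal.{0}, StrictMonoOn c (Iio o.cof.ord) ∧
      MapsTo c (Iio o.cof.ord) (Iio o) ∧ ∀ b < o, ∃ a < o.cof.ord, b ≤ c a := by
  classical
  obtain ⟨F, hF⟩ := Ordinal.exists_isFundamentalSeq (o := o) rfl
  refine ⟨fun a => if h : a < o.cof.ord then F ⟨a, h⟩ else 0, ?_, ?_, ?_⟩
  · intro a ha b hb hab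
    have ha' : a < o.cof.ord := ha
    have hb' : b < o.cof.ord := hb
    simp only [ha', hb', dite_true]
    exact hF.strictMono (show (⟨a, ha⟩ : Iio o.cof.ord) < ⟨b, hb⟩ from hab)
  · intro a ha
    have ha' : a < o.cof.ord := ha
    simp only [ha', dite_true]
    exact (F ⟨a, ha⟩).2
  · intro b hb
    obtain ⟨_, ⟨a, rfl⟩, hba⟩ := hF.isCofinal_range ⟨b, hb⟩
    have ha' : a.1 < o.cof.ord := a.2
    refine ⟨a, ha', ?_⟩
    simp only [ha', dite_true]
    exact hba

theorem lub_le_of_subset_Iio {A : Set Ordinal.{0}} {l : Ordinal.{0}} (h : A ⊆ Iio l) :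
    lub A ≤ l := by
  refine csSup_le' ?_
  rintro _ ⟨a, ha, rfl⟩
  exact Order.add_one_le_of_lt (h ha)

theorem UnbSub.le_lub {A : Set Ordinal.{0}} {l : Ordinal.{0}} (h : UnbSub A l) :
    l ≤ lub A := by
  refine le_of_forall_lt fun b hb => ?_
  obtain ⟨a, ha, hba⟩ := h.2 b hb
  refine (lt_of_le_of_lt hba (lt_add_one a)).trans_le (le_csSup ⟨l, ?_⟩ ⟨a, ha, rfl⟩)
  rintro _ ⟨x, hx, rfl⟩
  exact Order.add_one_le_of_lt (h.1 hx)

/-- If there is an unbounded subset of `cof(λ)^{Ult(V,U)}` that is fresh over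
`Ult(V,U)`, then there is an unbounded subset of `λ` that is fresh over `Ult(V,U)`. -/
theorem stmt17 (δ : Cardinal.{0}) (U : Ultrafilter (Idx δ)) (hU : IsNormalUltrafilter δ U)
    (l : Ordinal.{0}) (hl : Order.IsSuccLimit l)
    (h : ∃ A : Set Ordinal.{0}, UnbSub A (cofUlt hU l) ∧ Fresh hU A) :
    ∃ B : Set Ordinal.{0}, UnbSub B l ∧ Fresh hU B := by
  obtain ⟨A, hA, hAnot, hAfresh⟩ := h
  obtain ⟨f, rfl⟩ := ordRank_surjective hU l
  rw [cofUlt_ordRank] at hA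
  choose c hmono hmaps hcof using fun i => exists_strictMonoOn_cofinal (f i)
  have lt_of_mem : ∀ {g : Idx δ → Ordinal.{0}}, ordRank hU g ∈ A →
      ∀ᶠ i in (U : Filter (Idx δ)), g i < (f i).cof.ord := fun hg =>
    (ordRank_lt_iff hU).1 (hA.1 hg)
  have exists_le : ∀ b : Idx δ → Ordinal.{0}, ordRank hU b < ordRank hU f →
      ∃ a : Idx δ → Ordinal.{0}, ordRank hU a < ordRank hU (fun i => (f i).cof.ord) ∧
        ∀ᶠ i in (U : Filter (Idx δ)), b i ≤ c i (a i) := by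
    intro b hb
    have hb' := (ordRank_lt_iff hU).1 hb
    have key : ∀ i, ∃ a, b i < f i → a < (f i).cof.ord ∧ b i ≤ c i a := by
      intro i
      by_cases hi : b i < f i
      · obtain ⟨a, ha⟩ := hcof i _ hi
        exact ⟨a, fun _ => ha⟩
      · exact ⟨0, fun h => absurd h hi⟩
    choose a ha using key
    exact ⟨a, (ordRank_lt_iff hU).2 (hb'.mono fun i hi => (ha i hi).1),
      hb'.mono fun i hi => (ha i hi).2⟩
  set B : Set Ordinal.{0} :=
    {o | ∃ g : Idx δ → Ordinal.{0}, ordRank hU g ∈ A ∧ ordRank hU (fun i => c i (g i)) = o} with hB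
  have hBsub : B ⊆ Iio (ordRank hU f) := by
    rintro _ ⟨g, hg, rfl⟩
    exact (ordRank_lt_iff hU).2 ((lt_of_mem hg).mono fun i hi => hmaps i hi)
  refine ⟨B, ⟨hBsub, ?_⟩, ?_, ?_⟩
  · intro β hβ
    obtain ⟨b, rfl⟩ := ordRank_surjective hU β
    obtain ⟨a, ha, hba⟩ := exists_le b hβ
    obtain ⟨x, hx, hax⟩ := hA.2 _ ha
    obtain ⟨g, rfl⟩ := ordRank_surjective hU x
    refine ⟨_, ⟨g, hx, rfl⟩, (ordRank_le_iff hU).2 ?_⟩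
    filter_upwards [hba, (ordRank_le_iff hU).1 hax, lt_of_mem hx] with i h₁ h₂ h₃
    exact h₁.trans ((hmono i).monotoneOn (lt_of_le_of_lt h₂ h₃) h₃ h₂)
  · rintro ⟨b, -, hb⟩
    refine hAnot ⟨fun i => {x | x < (f i).cof.ord ∧ c i x ∈ b i},
      fun i => ⟨(f i).cof.ord, fun x hx => hx.1.le⟩, ?_⟩
    ext x
    obtain ⟨g, rfl⟩ := ordRank_surjective hU x
    rw [ordRank_mem_ultSet_iff]
    constructor
    · intro hg
      have hmem : ordRank hU (fun i => c i (g i)) ∈ ultSet hU b := hb ▸ ⟨g, hg, rfl⟩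
      exact (lt_of_mem hg).and ((ordRank_mem_ultSet_iff hU).1 hmem)
    · intro hg
      have hmem : ordRank hU (fun i => c i (g i)) ∈ B := by
        rw [hb, ordRank_mem_ultSet_iff]
        exact hg.mono fun i hi => hi.2
      obtain ⟨k, hk, hkg⟩ := hmem
      have : ordRank hU k = ordRank hU g := by
        refine (ordRank_eq_iff hU).2 ?_
        filter_upwards [hg, (ordRank_eq_iff hU).1 hkg, lt_of_mem hk] with i h₁ h₂ h₃
        exact (hmono i).injOn h₃ h₁.1 h₂
      exact this ▸ hk
  · intro β hβ
    replace hβ := hβ.trans_le (lub_le_of_subset_Iio hBsub)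
    obtain ⟨b, rfl⟩ := ordRank_surjective hU β
    obtain ⟨a, ha, hba⟩ := exists_le b hβ
    obtain ⟨s, -, hs⟩ := hAfresh _ (ha.trans_le hA.le_lub)
    refine ⟨fun i => c i '' (s i ∩ Iio (f i).cof.ord) ∩ Iio (b i),
      fun i => ⟨b i, fun x hx => le_of_lt hx.2⟩, ?_⟩
    ext x
    constructor
    · rintro ⟨⟨g, hg, rfl⟩, hgb⟩
      have hgb' := (ordRank_lt_iff hU).1 hgb
      have hga : ordRank hU g < ordRank hU a := by
        refine (ordRank_lt_iff hU).2 ?_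
        filter_upwards [hgb', hba, lt_of_mem hg, (ordRank_lt_iff hU).1 ha] with i h₁ h₂ h₃ h₄
        exact ((hmono i).lt_iff_lt h₃ h₄).1 (lt_of_lt_of_le h₁ h₂)
      have hgs : ordRank hU g ∈ ultSet hU s := hs ▸ ⟨hg, hga⟩
      rw [ordRank_mem_ultSet_iff] at hgs ⊢
      filter_upwards [hgs, lt_of_mem hg, hgb'] with i h₁ h₂ h₃
      exact ⟨⟨g i, ⟨h₁, h₂⟩, rfl⟩, h₃⟩
    · rintro ⟨y, hy, rfl⟩
      have key : ∀ i, ∃ z, y i ∈ c i '' (s i ∩ Iio (f i).cof.ord) → z ∈ s i ∧ c i z = y i := by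
        intro i
        by_cases hi : y i ∈ c i '' (s i ∩ Iio (f i).cof.ord)
        · obtain ⟨z, hz, hzy⟩ := hi
          exact ⟨z, fun _ => ⟨hz.1, hzy⟩⟩
        · exact ⟨0, fun h => absurd h hi⟩
      choose z hz using key
      have hzs : ordRank hU z ∈ ultSet hU s :=
        (ordRank_mem_ultSet_iff hU).2 (Filter.mem_of_superset hy fun i hi => (hz i hi.1).1)
      rw [← hs] at hzs
      exact ⟨⟨z, hzs.1, (ordRank_eq_iff hU).2
          (Filter.mem_of_superset hy fun i hi => (hz i hi.1).2)⟩,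
        (ordRank_lt_iff hU).2 (Filter.mem_of_superset hy fun i hi => hi.2)⟩

end MU
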